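/- arXiv:1303.4358 — 2 statements merged into one kernel-verified Lean document; each statement's English description precedes it below -/
import Mathlib

section
/- For every z∈ℂ one has M₂(z) = M₅(z) − M₁(z) = (π/2)·Σ_{p=0}^∞ Γ(p+1/2)/((p!)²·(p+1)) · z^{2p}, the power series having infinite radius of convergence and all coefficients positive; in particular M₂ extends to an entire function which is not identically zero. -/
open MeasureTheory

/-- `M₁(z) = ∫₀^∞ e^{-r²} (∫₀^{2π} e^{2rz cos θ} cos²θ dθ) dr`. -/
noncomputable def M1 (z : ℂ) : ℂ :=
  ∫ r in Set.Ioi (0 : ℝ),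
    Complex.exp (-(r : ℂ) ^ 2) *
      ∫ θ in (0 : ℝ)..(2 * Real.pi),
        Complex.exp (2 * (r : ℂ) * z * (Real.cos θ : ℂ)) * (Real.cos θ : ℂ) ^ 2

/-- `M₂(z) = ∫₀^∞ e^{-r²} (∫₀^{2π} e^{2rz cos θ} sin²θ dθ) dr`. -/
noncomputable def M2 (z : ℂ) : ℂ :=
  ∫ r in Set.Ioi (0 : ℝ),
    Complex.exp (-(r : ℂ) ^ 2) *
      ∫ θ in (0 : ℝ)..(2 * Real.pi),
        Complex.exp (2 * (r : ℂ) * z * (Real.cos θ : ℂ)) * (Real.sin θ : ℂ) ^ 2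

/-- `M₅(z) = ∫₀^∞ e^{-r²} (∫₀^{2π} e^{2rz cos θ} dθ) dr`. -/
noncomputable def M5 (z : ℂ) : ℂ :=
  ∫ r in Set.Ioi (0 : ℝ),
    Complex.exp (-(r : ℂ) ^ 2) *
      ∫ θ in (0 : ℝ)..(2 * Real.pi),
        Complex.exp (2 * (r : ℂ) * z * (Real.cos θ : ℂ))

/-- The `p`-th coefficient of the expansion of `M2` in powers of `z ^ 2`, without `π / 2`. -/
noncomputable def coeffM2 (p : ℕ) : ℝ :=
  Real.Gamma ((p : ℝ) + 1 / 2) / ((Nat.factorial p : ℝ) ^ 2 * ((p : ℝ) + 1))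

lemma coeffM2_pos (p : ℕ) : 0 < coeffM2 p := by
  have := Real.Gamma_pos_of_pos (show 0 < (p : ℝ) + 1 / 2 by positivity)
  unfold coeffM2
  positivity

lemma Gamma_nat_add_half_le (p : ℕ) :
    Real.Gamma ((p : ℝ) + 1 / 2) ≤ √Real.pi * (Nat.factorial p : ℝ) := by
  induction p with
  | zero => simpa using Real.Gamma_one_half_eq.le
  | succ p ih =>
    have h : ((p + 1 : ℕ) : ℝ) + 1 / 2 = ((p : ℝ) + 1 / 2) + 1 := by push_cast; ring
    rw [h, Real.Gamma_add_one (by positivity), Nat.factorial_succ]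
    push_cast
    calc ((p : ℝ) + 1 / 2) * Real.Gamma ((p : ℝ) + 1 / 2)
        ≤ ((p : ℝ) + 1) * (√Real.pi * (Nat.factorial p : ℝ)) := by
          refine mul_le_mul (by linarith) ih ?_ (by positivity)
          exact (Real.Gamma_pos_of_pos (by positivity)).le
      _ = _ := by ring

lemma coeffM2_le (p : ℕ) : coeffM2 p ≤ √Real.pi / (Nat.factorial p : ℝ) := by
  have h1 : (1 : ℝ) ≤ Nat.factorial p := by exact_mod_cast Nat.factorial_pos p
  unfold coeffM2
  rw [div_le_div_iff₀ (by positivity) (by positivity)]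
  calc Real.Gamma ((p : ℝ) + 1 / 2) * (Nat.factorial p : ℝ)
      ≤ (√Real.pi * (Nat.factorial p : ℝ)) * (Nat.factorial p : ℝ) := by
        gcongr; exact Gamma_nat_add_half_le p
    _ ≤ (√Real.pi * (Nat.factorial p : ℝ)) * (Nat.factorial p : ℝ) * ((p : ℝ) + 1) :=
        le_mul_of_one_le_right (by positivity) (by linarith [Nat.cast_nonneg (α := ℝ) p])
    _ = _ := by ring

lemma norm_coeffM2_mul_pow_le {z : ℂ} {R : ℝ} (hz : ‖z‖ ≤ R) (p : ℕ) :
    ‖(coeffM2 p : ℂ) * z ^ (2 * p)‖ ≤ √Real.pi * ((R ^ 2) ^ p / (Nat.factorial p : ℝ)) := by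
  rw [norm_mul, norm_pow, Complex.norm_real, Real.norm_of_nonneg (coeffM2_pos p).le, pow_mul]
  calc coeffM2 p * (‖z‖ ^ 2) ^ p ≤ √Real.pi / (Nat.factorial p : ℝ) * (R ^ 2) ^ p := by
        gcongr; exact coeffM2_le p
    _ = _ := by ring

lemma summable_coeffM2_bound (R : ℝ) :
    Summable (fun p : ℕ => √Real.pi * ((R ^ 2) ^ p / (Nat.factorial p : ℝ))) :=
  (Real.summable_pow_div_factorial (R ^ 2)).mul_left _

lemma summable_coeffM2 (z : ℂ) : Summable (fun p : ℕ => (coeffM2 p : ℂ) * z ^ (2 * p)) :=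
  .of_norm_bounded (summable_coeffM2_bound ‖z‖) fun p => norm_coeffM2_mul_pow_le le_rfl p

lemma differentiable_tsum_coeffM2 :
    Differentiable ℂ (fun z : ℂ => ∑' p : ℕ, (coeffM2 p : ℂ) * z ^ (2 * p)) := by
  intro z
  have hd : DifferentiableOn ℂ (fun z : ℂ => ∑' p : ℕ, (coeffM2 p : ℂ) * z ^ (2 * p))
      (Metric.ball 0 (‖z‖ + 1)) :=
    Complex.differentiableOn_tsum_of_summable_norm (summable_coeffM2_bound (‖z‖ + 1))
      (fun p => by fun_prop) Metric.isOpen_ball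
      fun p w hw => norm_coeffM2_mul_pow_le (mem_ball_zero_iff.1 hw).le p
  exact hd.differentiableAt (Metric.isOpen_ball.mem_nhds (by simp))

lemma integral_cos_pow_add_two (n : ℕ) :
    ∫ θ in (0 : ℝ)..(2 * Real.pi), Real.cos θ ^ (n + 2) =
      ((n : ℝ) + 1) / (n + 2) * ∫ θ in (0 : ℝ)..(2 * Real.pi), Real.cos θ ^ n := by
  rw [integral_cos_pow]
  simp

lemma integral_cos_pow_odd (p : ℕ) :
    ∫ θ in (0 : ℝ)..(2 * Real.pi), Real.cos θ ^ (2 * p + 1) = 0 := by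
  induction p with
  | zero => simp
  | succ p ih =>
    rw [show 2 * (p + 1) + 1 = (2 * p + 1) + 2 by ring, integral_cos_pow_add_two, ih, mul_zero]

lemma integral_cos_pow_even (p : ℕ) :
    ∫ θ in (0 : ℝ)..(2 * Real.pi), Real.cos θ ^ (2 * p) =
      2 * Real.pi * (Nat.factorial (2 * p) : ℝ) / (4 ^ p * (Nat.factorial p : ℝ) ^ 2) := by
  induction p with
  | zero => simp
  | succ p ih =>
    rw [show 2 * (p + 1) = 2 * p + 2 by ring, integral_cos_pow_add_two, ih]
    simp only [Nat.factorial_succ]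
    push_cast
    field_simp
    ring

lemma integral_cos_pow_mul_sin_sq (n : ℕ) :
    ∫ θ in (0 : ℝ)..(2 * Real.pi), Real.cos θ ^ n * Real.sin θ ^ 2 =
      (∫ θ in (0 : ℝ)..(2 * Real.pi), Real.cos θ ^ n) / (n + 2) := by
  have h : ∀ θ : ℝ, Real.cos θ ^ n * Real.sin θ ^ 2 = Real.cos θ ^ n - Real.cos θ ^ (n + 2) := by
    intro θ
    rw [Real.sin_sq]
    ring
  simp_rw [h]
  rw [intervalIntegral.integral_sub ((by fun_prop : Continuous _).intervalIntegrable _ _)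
    ((by fun_prop : Continuous _).intervalIntegrable _ _), integral_cos_pow_add_two]
  field_simp
  ring

/-- Power series of the angular integral in `M2`. -/
lemma hasSum_integral_cexp_cos_mul_sin_sq (w : ℂ) :
    HasSum (fun p : ℕ => ((Real.pi / ((Nat.factorial p : ℝ) ^ 2 * ((p : ℝ) + 1)) : ℝ) : ℂ) *
        w ^ (2 * p))
      (∫ θ in (0 : ℝ)..(2 * Real.pi),
        Complex.exp (2 * w * (Real.cos θ : ℂ)) * (Real.sin θ : ℂ) ^ 2) := by
  have hsum : HasSum
      (fun n : ℕ => ∫ θ in (0 : ℝ)..(2 * Real.pi),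
        (2 * w * (Real.cos θ : ℂ)) ^ n / (Nat.factorial n : ℂ) * (Real.sin θ : ℂ) ^ 2)
      (∫ θ in (0 : ℝ)..(2 * Real.pi),
        Complex.exp (2 * w * (Real.cos θ : ℂ)) * (Real.sin θ : ℂ) ^ 2) := by
    refine intervalIntegral.hasSum_integral_of_dominated_convergence
      (fun n _ => ‖2 * w‖ ^ n / (Nat.factorial n : ℝ)) (fun n => ?_) (fun n => ?_) ?_ ?_ ?_
    · exact (by fun_prop : Continuous _).aestronglyMeasurable
    · refine .of_forall fun θ _ => ?_
      rw [norm_mul, norm_div, norm_pow, norm_pow, norm_mul, Complex.norm_real, Complex.norm_real,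
        Complex.norm_natCast, Real.norm_eq_abs, Real.norm_eq_abs]
      refine (mul_le_of_le_one_right (by positivity)
        (pow_le_one₀ (abs_nonneg _) (Real.abs_sin_le_one θ))).trans ?_
      gcongr
      exact mul_le_of_le_one_right (norm_nonneg _) (Real.abs_cos_le_one θ)
    · exact .of_forall fun θ _ => Real.summable_pow_div_factorial _
    · exact continuous_const.intervalIntegrable _ _
    · refine .of_forall fun θ _ => ?_
      have h := NormedSpace.expSeries_div_hasSum_exp (2 * w * (Real.cos θ : ℂ))
      rw [← Complex.exp_eq_exp_ℂ] at h
      exact h.mul_right ((Real.sin θ : ℂ) ^ 2)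
  have hterm : ∀ n : ℕ, ∫ θ in (0 : ℝ)..(2 * Real.pi),
        (2 * w * (Real.cos θ : ℂ)) ^ n / (Nat.factorial n : ℂ) * (Real.sin θ : ℂ) ^ 2 =
      (2 * w) ^ n / (Nat.factorial n : ℂ) *
        (((∫ θ in (0 : ℝ)..(2 * Real.pi), Real.cos θ ^ n) / (n + 2) : ℝ) : ℂ) := by
    intro n
    rw [← integral_cos_pow_mul_sin_sq, ← intervalIntegral.integral_ofReal,
      ← intervalIntegral.integral_const_mul]
    congr 1 with θ
    push_cast
    ring
  simp_rw [hterm] at hsum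
  have hinj : Function.Injective (fun p : ℕ => 2 * p) := fun a b h => by simpa using h
  rw [← hinj.hasSum_iff] at hsum
  · convert hsum using 2 with p
    simp only [Function.comp_apply]
    rw [integral_cos_pow_even, mul_pow, pow_mul 2 2 p]
    have : (Nat.factorial (2 * p) : ℂ) ≠ 0 := by exact_mod_cast Nat.factorial_ne_zero _
    have : (Nat.factorial p : ℂ) ≠ 0 := by exact_mod_cast Nat.factorial_ne_zero _
    have : (p : ℂ) + 1 ≠ 0 := by exact_mod_cast Nat.succ_ne_zero p
    have : 2 * (p : ℂ) + 2 ≠ 0 := by exact_mod_cast Nat.succ_ne_zero (2 * p + 1)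
    push_cast
    norm_num
    field_simp
  · intro n hn
    obtain ⟨p, rfl | rfl⟩ := n.even_or_odd'
    · exact absurd ⟨p, rfl⟩ hn
    · rw [integral_cos_pow_odd]
      simp

lemma integral_pow_mul_exp_neg_sq (p : ℕ) :
    ∫ r in Set.Ioi (0 : ℝ), r ^ (2 * p) * Real.exp (-r ^ 2) =
      Real.Gamma ((p : ℝ) + 1 / 2) / 2 := by
  have h := integral_rpow_mul_exp_neg_rpow (p := 2) (q := ((2 * p : ℕ) : ℝ)) (by norm_num)
    (by linarith [Nat.cast_nonneg (α := ℝ) (2 * p)])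
  simp only [Real.rpow_natCast, Real.rpow_two] at h
  rw [h, show (((2 * p : ℕ) : ℝ) + 1) / 2 = (p : ℝ) + 1 / 2 by push_cast; ring]
  ring

lemma integrableOn_pow_mul_exp_neg_sq (n : ℕ) :
    IntegrableOn (fun r : ℝ => r ^ n * Real.exp (-r ^ 2)) (Set.Ioi 0) := by
  have h := integrableOn_rpow_mul_exp_neg_mul_sq (b := 1) one_pos (s := (n : ℝ))
    (by linarith [Nat.cast_nonneg (α := ℝ) n])
  simpa only [Real.rpow_natCast, neg_mul, one_mul] using h

lemma hasSum_M2 (z : ℂ) :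
    HasSum (fun p : ℕ => ((Real.pi : ℂ) / 2) * ((coeffM2 p : ℂ) * z ^ (2 * p))) (M2 z) := by
  set a : ℕ → ℝ := fun p => Real.pi / ((Nat.factorial p : ℝ) ^ 2 * ((p : ℝ) + 1)) with ha
  have ha0 : ∀ p, 0 ≤ a p := fun p => by positivity
  have haG : ∀ p, a p * (Real.Gamma ((p : ℝ) + 1 / 2) / 2) = Real.pi / 2 * coeffM2 p := by
    intro p
    simp only [ha, coeffM2]
    ring
  let F : ℕ → ℝ → ℂ := fun p r =>
    ((a p : ℂ) * z ^ (2 * p)) * ((r ^ (2 * p) * Real.exp (-r ^ 2) : ℝ) : ℂ)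
  have hF_int : ∀ p, Integrable (F p) (volume.restrict (Set.Ioi 0)) := fun p =>
    (integrableOn_pow_mul_exp_neg_sq (2 * p)).integrable.ofReal.const_mul _
  have hF_norm : ∀ p, ∫ r in Set.Ioi (0 : ℝ), ‖F p r‖ =
      ‖((Real.pi : ℂ) / 2) * ((coeffM2 p : ℂ) * z ^ (2 * p))‖ := by
    intro p
    have h : ∀ r : ℝ, ‖F p r‖ = (a p * ‖z‖ ^ (2 * p)) * (r ^ (2 * p) * Real.exp (-r ^ 2)) := by
      intro r
      simp only [F]
      rw [norm_mul, norm_mul, norm_pow, Complex.norm_real, Complex.norm_real,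
        Real.norm_of_nonneg (ha0 p), Real.norm_of_nonneg
          (mul_nonneg ((even_two_mul p).pow_nonneg r) (Real.exp_pos _).le)]
    simp_rw [h]
    rw [integral_const_mul, integral_pow_mul_exp_neg_sq, mul_right_comm, haG]
    simp [abs_of_pos Real.pi_pos, abs_of_pos (coeffM2_pos p)]
    ring
  have hF_eq : ∀ p, ∫ r in Set.Ioi (0 : ℝ), F p r =
      ((Real.pi : ℂ) / 2) * ((coeffM2 p : ℂ) * z ^ (2 * p)) := by
    intro p
    simp only [F]
    rw [integral_const_mul, integral_complex_ofReal, integral_pow_mul_exp_neg_sq, mul_right_comm,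
      ← Complex.ofReal_mul, haG]
    push_cast
    ring
  have key := hasSum_integral_of_summable_integral_norm hF_int (by
    simp_rw [hF_norm]
    exact ((summable_coeffM2 z).mul_left _).norm)
  simp_rw [hF_eq] at key
  refine (show M2 z = _ from ?_) ▸ key
  refine integral_congr_ae (.of_forall fun r => ?_)
  have h := (hasSum_integral_cexp_cos_mul_sin_sq ((r : ℂ) * z)).mul_left
    (Complex.exp (-(r : ℂ) ^ 2))
  simp only [← mul_assoc] at h
  simp only
  rw [← h.tsum_eq]
  refine tsum_congr fun p => ?_
  simp only [F, ha]
  push_cast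
  rw [mul_pow]
  ring

/-- The radial integrands are integrable for every continuous angular weight. -/
lemma integrableOn_exp_neg_sq_mul_angular (z : ℂ) {f : ℝ → ℂ} (hf : Continuous f)
    (hf1 : ∀ θ, ‖f θ‖ ≤ 1) :
    IntegrableOn (fun r : ℝ => Complex.exp (-(r : ℂ) ^ 2) *
      ∫ θ in (0 : ℝ)..(2 * Real.pi),
        Complex.exp (2 * (r : ℂ) * z * (Real.cos θ : ℂ)) * f θ) (Set.Ioi 0) := by
  have hg : Integrable (fun r : ℝ => Complex.exp (-1 * (r : ℂ) ^ 2 + (2 * ‖z‖ : ℝ) * r + 0)) :=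
    integrable_cexp_quadratic' (by simp) _ _
  refine Integrable.mono' (hg.norm.const_mul (2 * Real.pi)).integrableOn ?_ ?_
  · refine Continuous.aestronglyMeasurable (.mul (by fun_prop) ?_)
    exact intervalIntegral.continuous_parametric_intervalIntegral_of_continuous'
      (by unfold Function.uncurry; fun_prop) _ _
  · refine (ae_restrict_mem measurableSet_Ioi).mono fun r hr => ?_
    have hr : 0 < r := hr
    have hI : ‖∫ θ in (0 : ℝ)..(2 * Real.pi),
        Complex.exp (2 * (r : ℂ) * z * (Real.cos θ : ℂ)) * f θ‖ ≤
        Real.exp (2 * ‖z‖ * r) * |2 * Real.pi - 0| := by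
      refine intervalIntegral.norm_integral_le_of_norm_le_const fun θ _ => ?_
      rw [norm_mul]
      refine (mul_le_of_le_one_right (norm_nonneg _) (hf1 θ)).trans ?_
      refine (Complex.norm_exp_le_exp_norm _).trans (Real.exp_le_exp.2 ?_)
      rw [norm_mul, Complex.norm_real, Real.norm_eq_abs]
      refine (mul_le_of_le_one_right (norm_nonneg _) (Real.abs_cos_le_one θ)).trans ?_
      simp only [norm_mul, Complex.norm_real, Real.norm_of_nonneg hr.le, Complex.norm_ofNat]
      linarith
    rw [sub_zero, abs_of_pos Real.two_pi_pos] at hI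
    rw [norm_mul, Complex.norm_exp, Complex.norm_exp]
    refine (mul_le_mul_of_nonneg_left hI (Real.exp_pos _).le).trans_eq ?_
    have h1 : (-(r : ℂ) ^ 2).re = -r ^ 2 := by
      exact_mod_cast Complex.ofReal_re (-r ^ (2 : ℕ))
    have h2 : (-1 * (r : ℂ) ^ 2 + (2 * ‖z‖ : ℝ) * r + 0).re = -r ^ 2 + 2 * ‖z‖ * r := by
      rw [add_zero, neg_one_mul]
      exact_mod_cast Complex.ofReal_re (-r ^ (2 : ℕ) + 2 * ‖z‖ * r)
    rw [h1, h2, Real.exp_add]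
    ring

lemma M2_eq_M5_sub_M1 (z : ℂ) : M2 z = M5 z - M1 z := by
  have h5 := integrableOn_exp_neg_sq_mul_angular z (f := fun _ => 1) continuous_const (by simp)
  have h1 := integrableOn_exp_neg_sq_mul_angular z (f := fun θ => (Real.cos θ : ℂ) ^ 2)
    (by fun_prop) (fun θ => by
      rw [norm_pow, Complex.norm_real]
      exact pow_le_one₀ (norm_nonneg _) (Real.abs_cos_le_one θ))
  simp only [mul_one] at h5
  unfold M2 M5 M1
  rw [← integral_sub h5 h1]
  congr 1 with r
  rw [← mul_sub, ← intervalIntegral.integral_sub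
    ((by fun_prop : Continuous _).intervalIntegrable _ _)
    ((by fun_prop : Continuous _).intervalIntegrable _ _)]
  congr 2 with θ
  push_cast
  rw [Complex.sin_sq]
  ring

lemma M2_eq_tsum (z : ℂ) :
    M2 z = ((Real.pi : ℂ) / 2) * ∑' p : ℕ, (coeffM2 p : ℂ) * z ^ (2 * p) := by
  rw [← tsum_mul_left, (hasSum_M2 z).tsum_eq]

lemma M2_zero_ne_zero : M2 0 ≠ 0 := by
  rw [M2_eq_tsum, tsum_eq_single 0 fun p hp => by simp [hp]]
  simp [Real.pi_ne_zero, (coeffM2_pos 0).ne']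

/-- `M₂ = M₅ − M₁ = (π/2) Σ_p Γ(p+1/2)/((p!)²(p+1)) z^{2p}`, the power series having
infinite radius of convergence and positive coefficients; in particular `M₂` is an
entire function which is not identically zero. -/
theorem stmt5 :
    (∀ z : ℂ, Summable (fun p : ℕ =>
        ((Real.Gamma ((p : ℝ) + 1 / 2) /
            (((Nat.factorial p : ℝ)) ^ 2 * ((p : ℝ) + 1)) : ℝ) : ℂ) * z ^ (2 * p))) ∧
    (∀ z : ℂ, M2 z = M5 z - M1 z) ∧
    (∀ z : ℂ, M2 z =
        ((Real.pi : ℂ) / 2) * ∑' p : ℕ,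
          ((Real.Gamma ((p : ℝ) + 1 / 2) /
              (((Nat.factorial p : ℝ)) ^ 2 * ((p : ℝ) + 1)) : ℝ) : ℂ) * z ^ (2 * p)) ∧
    (∀ p : ℕ, 0 < Real.Gamma ((p : ℝ) + 1 / 2) /
        (((Nat.factorial p : ℝ)) ^ 2 * ((p : ℝ) + 1))) ∧
    Differentiable ℂ M2 ∧
    (∃ z : ℂ, M2 z ≠ 0) := by
  exact ⟨summable_coeffM2, M2_eq_M5_sub_M1, M2_eq_tsum, coeffM2_pos,
    (funext M2_eq_tsum : M2 = _) ▸ differentiable_tsum_coeffM2.const_mul _, 0, M2_zero_ne_zero⟩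
end

section
/- For every ε>0 and every η₀∈ℝ² with 0<|η₀|≤ε, the principal value p.v.∫_{ℝ²} α_{ε,η₀}(η)·⟨η, η−η₀⟩/|η|³ dη exists and equals (e^{−r̄₀²}/ε)·( M₅(r̄₀) − r̄₀²·M₃(r̄₀) ), where r̄₀ = |η₀|/ε. -/
open MeasureTheory
open scoped RealInnerProductSpace

/-- `α_{ε,η₀}(η) = ε⁻² exp(-|η-η₀|²/ε²)`. -/
noncomputable def alphaFn (ε : ℝ) (η₀ η : EuclideanSpace ℝ (Fin 2)) : ℝ :=
  ε⁻¹ ^ 2 * Real.exp (-‖η - η₀‖ ^ 2 / ε ^ 2)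

/-- `M₃(z) = z⁻¹ ∫₀^∞ r⁻¹ e^{-r²} (∫₀^{2π} e^{2rz cos θ} cos θ dθ) dr` (real argument). -/
noncomputable def M3R (z : ℝ) : ℝ :=
  z⁻¹ * ∫ r in Set.Ioi (0 : ℝ),
    r⁻¹ * Real.exp (-r ^ 2) *
      ∫ θ in (0 : ℝ)..(2 * Real.pi), Real.exp (2 * r * z * Real.cos θ) * Real.cos θ

/-- `M₅(z) = ∫₀^∞ e^{-r²} (∫₀^{2π} e^{2rz cos θ} dθ) dr` (real argument). -/
noncomputable def M5R (z : ℝ) : ℝ :=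
  ∫ r in Set.Ioi (0 : ℝ),
    Real.exp (-r ^ 2) *
      ∫ θ in (0 : ℝ)..(2 * Real.pi), Real.exp (2 * r * z * Real.cos θ)

theorem integrable_exp_neg_sq_add_mul (c : ℝ) :
    Integrable fun r : ℝ => Real.exp (-r ^ 2 + c * r) := by
  have h := ((integrable_exp_neg_mul_sq one_pos).comp_sub_right (c / 2)).const_mul
    (Real.exp (c ^ 2 / 4))
  refine h.congr (ae_of_all _ fun r => ?_)
  simp only [← Real.exp_add]
  congr 1
  ring

theorem abs_exp_sub_one_le_mul_exp_abs (x : ℝ) : |Real.exp x - 1| ≤ |x| * Real.exp |x| := by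
  rcases le_total 0 x with hx | hx
  · rw [abs_of_nonneg hx, abs_of_nonneg (by linarith [Real.add_one_le_exp x])]
    have h1 := Real.add_one_le_exp (-x)
    have h2 : Real.exp (-x) * Real.exp x = 1 := by rw [← Real.exp_add]; simp
    nlinarith [Real.exp_pos x]
  · rw [abs_of_nonpos hx, abs_of_nonpos (by linarith [Real.exp_le_one_iff.2 hx])]
    have h1 := Real.add_one_le_exp x
    have h2 := Real.add_one_le_exp (-x)
    nlinarith

theorem abs_two_mul_mul_mul_cos_le {r z : ℝ} (hr : 0 ≤ r) (hz : 0 ≤ z) (θ : ℝ) :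
    |2 * r * z * Real.cos θ| ≤ 2 * z * r := by
  rw [abs_mul, abs_of_nonneg (by positivity)]
  nlinarith [Real.abs_cos_le_one θ, mul_nonneg hr hz]

theorem integrableOn_exp_mul_integral_exp_cos {z : ℝ} (hz : 0 ≤ z) :
    IntegrableOn (fun r : ℝ => Real.exp (-r ^ 2) *
      ∫ θ in (0 : ℝ)..(2 * Real.pi), Real.exp (2 * r * z * Real.cos θ)) (Set.Ioi 0) := by
  have hc : Continuous fun r : ℝ =>
      ∫ θ in (0 : ℝ)..(2 * Real.pi), Real.exp (2 * r * z * Real.cos θ) :=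
    intervalIntegral.continuous_parametric_intervalIntegral_of_continuous' (by fun_prop) _ _
  refine Integrable.mono' ((integrable_exp_neg_sq_add_mul (2 * z)).mul_const
    (2 * Real.pi)).integrableOn (by fun_prop) ?_
  filter_upwards [ae_restrict_mem measurableSet_Ioi] with r hr
  have hb := intervalIntegral.norm_integral_le_of_norm_le_const (a := 0) (b := 2 * Real.pi)
    (C := Real.exp (2 * z * r)) (f := fun θ => Real.exp (2 * r * z * Real.cos θ)) fun θ _ => by
      rw [Real.norm_eq_abs, Real.abs_exp, Real.exp_le_exp]
      exact (le_abs_self _).trans (abs_two_mul_mul_mul_cos_le (le_of_lt hr) hz θ)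
  rw [sub_zero, abs_of_pos Real.two_pi_pos] at hb
  rw [norm_mul, Real.norm_eq_abs, Real.abs_exp, Real.exp_add, mul_assoc (Real.exp _)]
  exact mul_le_mul_of_nonneg_left hb (Real.exp_pos _).le

theorem integrableOn_inv_mul_exp_mul_integral_exp_cos_mul_cos {z : ℝ} (hz : 0 ≤ z) :
    IntegrableOn (fun r : ℝ => r⁻¹ * Real.exp (-r ^ 2) *
      ∫ θ in (0 : ℝ)..(2 * Real.pi), Real.exp (2 * r * z * Real.cos θ) * Real.cos θ)
      (Set.Ioi 0) := by
  have hc : Continuous fun r : ℝ =>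
      ∫ θ in (0 : ℝ)..(2 * Real.pi), Real.exp (2 * r * z * Real.cos θ) * Real.cos θ :=
    intervalIntegral.continuous_parametric_intervalIntegral_of_continuous' (by fun_prop) _ _
  refine Integrable.mono' ((integrable_exp_neg_sq_add_mul (2 * z)).mul_const
    (2 * z * (2 * Real.pi))).integrableOn
    (((measurable_inv.mul (by fun_prop)).mul hc.measurable).aestronglyMeasurable) ?_
  filter_upwards [ae_restrict_mem measurableSet_Ioi] with r hr
  rw [Set.mem_Ioi] at hr
  have hsub : ∫ θ in (0 : ℝ)..(2 * Real.pi), Real.exp (2 * r * z * Real.cos θ) * Real.cos θ =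
      ∫ θ in (0 : ℝ)..(2 * Real.pi), (Real.exp (2 * r * z * Real.cos θ) - 1) * Real.cos θ := by
    simp_rw [sub_mul, one_mul]
    rw [intervalIntegral.integral_sub
      (Continuous.intervalIntegrable (by fun_prop) _ _)
      (Continuous.intervalIntegrable (by fun_prop) _ _)]
    simp
  have hb := intervalIntegral.norm_integral_le_of_norm_le_const (a := 0) (b := 2 * Real.pi)
    (C := 2 * z * r * Real.exp (2 * z * r))
    (f := fun θ => (Real.exp (2 * r * z * Real.cos θ) - 1) * Real.cos θ) fun θ _ => by
      have h := abs_two_mul_mul_mul_cos_le hr.le hz θ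
      rw [norm_mul, Real.norm_eq_abs, Real.norm_eq_abs]
      calc |Real.exp (2 * r * z * Real.cos θ) - 1| * |Real.cos θ|
          ≤ |Real.exp (2 * r * z * Real.cos θ) - 1| * 1 := by
            gcongr; exact Real.abs_cos_le_one θ
        _ ≤ 2 * z * r * Real.exp (2 * z * r) := by
            rw [mul_one]
            refine (abs_exp_sub_one_le_mul_exp_abs _).trans ?_
            gcongr
  rw [sub_zero, abs_of_pos Real.two_pi_pos, ← hsub] at hb
  rw [norm_mul, norm_mul, Real.norm_eq_abs, Real.norm_eq_abs, Real.abs_exp, Real.exp_add,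
    abs_of_pos (inv_pos.2 hr)]
  calc r⁻¹ * Real.exp (-r ^ 2) * _
      ≤ r⁻¹ * Real.exp (-r ^ 2) * (2 * z * r * Real.exp (2 * z * r) * (2 * Real.pi)) := by gcongr
    _ = _ := by field_simp

theorem integrableOn_polar_kernel {s z : ℝ} (hs : 0 < s) (hz : 0 ≤ z) :
    IntegrableOn (fun p : ℝ × ℝ => Real.exp (-p.1 ^ 2) *
      (Real.exp (2 * p.1 * z * Real.cos p.2) * (1 - z * Real.cos p.2 / p.1)))
      (Set.Ioi s ×ˢ Set.Ioo (-Real.pi) Real.pi) := by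
  have hdom : IntegrableOn (fun p : ℝ × ℝ => Real.exp (-p.1 ^ 2 + 2 * z * p.1) * (1 + z / s))
      (Set.Ioi s ×ˢ Set.Ioo (-Real.pi) Real.pi) := by
    rw [IntegrableOn, Measure.volume_eq_prod, ← Measure.prod_restrict]
    exact (integrable_exp_neg_sq_add_mul (2 * z)).integrableOn.mul_prod
      (integrable_const (1 + z / s))
  refine Integrable.mono' hdom (by fun_prop) ?_
  filter_upwards [ae_restrict_mem (measurableSet_Ioi.prod measurableSet_Ioo)] with p hp
  have hsp : s < p.1 := hp.1
  have hp0 : 0 < p.1 := hs.trans hsp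
  rw [norm_mul, norm_mul, Real.norm_eq_abs, Real.norm_eq_abs, Real.abs_exp, Real.abs_exp,
    ← mul_assoc, ← Real.exp_add]
  refine mul_le_mul ?_ ?_ (norm_nonneg _) (Real.exp_pos _).le
  · rw [Real.exp_le_exp, add_le_add_iff_left]
    exact (le_abs_self _).trans (abs_two_mul_mul_mul_cos_le hp0.le hz p.2)
  · refine (norm_sub_le _ _).trans ?_
    rw [norm_one, norm_div, norm_mul, Real.norm_eq_abs, Real.norm_eq_abs, Real.norm_eq_abs,
      abs_of_nonneg hz, abs_of_pos hp0]
    have : z * |Real.cos p.2| ≤ z := mul_le_of_le_one_right hz (Real.abs_cos_le_one _)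
    gcongr

theorem setIntegral_polar_kernel {s z : ℝ} (hs : 0 < s) (hz : 0 ≤ z) :
    ∫ p in Set.Ioi s ×ˢ Set.Ioo (-Real.pi) Real.pi, Real.exp (-p.1 ^ 2) *
      (Real.exp (2 * p.1 * z * Real.cos p.2) * (1 - z * Real.cos p.2 / p.1)) =
    ∫ r in Set.Ioi s, (Real.exp (-r ^ 2) *
        (∫ θ in (0 : ℝ)..(2 * Real.pi), Real.exp (2 * r * z * Real.cos θ)) -
      z * (r⁻¹ * Real.exp (-r ^ 2) *
        ∫ θ in (0 : ℝ)..(2 * Real.pi), Real.exp (2 * r * z * Real.cos θ) * Real.cos θ)) := by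
  rw [Measure.volume_eq_prod, setIntegral_prod _ (integrableOn_polar_kernel hs hz)]
  refine setIntegral_congr_fun measurableSet_Ioi fun r hr => ?_
  have hper : Function.Periodic (fun θ => Real.exp (2 * r * z * Real.cos θ) *
      (1 - z * Real.cos θ / r)) (2 * Real.pi) := fun θ => by simp only [Real.cos_add_two_pi]
  have hshift := hper.intervalIntegral_add_eq (-Real.pi) 0
  rw [zero_add, show -Real.pi + 2 * Real.pi = Real.pi by ring] at hshift
  simp only
  rw [integral_const_mul, ← integral_Ioc_eq_integral_Ioo,
    ← intervalIntegral.integral_of_le (by linarith [Real.pi_pos]), hshift]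
  have hsplit : ∀ θ, Real.exp (2 * r * z * Real.cos θ) * (1 - z * Real.cos θ / r) =
      Real.exp (2 * r * z * Real.cos θ) -
        z * r⁻¹ * (Real.exp (2 * r * z * Real.cos θ) * Real.cos θ) := fun θ => by
    rw [div_eq_mul_inv]; ring
  simp_rw [hsplit]
  rw [intervalIntegral.integral_sub
      (Continuous.intervalIntegrable (by fun_prop) _ _)
      (Continuous.intervalIntegrable (by fun_prop) _ _), intervalIntegral.integral_const_mul]
  ring

theorem Complex.setIntegral_lt_norm_eq_polarCoord {t : ℝ} (ht : 0 ≤ t) (f : ℂ → ℝ) :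
    ∫ w in {w : ℂ | t < ‖w‖}, f w =
      ∫ p in Set.Ioi t ×ˢ Set.Ioo (-Real.pi) Real.pi,
        p.1 * f (Complex.polarCoord.symm p) := by
  have hm : MeasurableSet {w : ℂ | t < ‖w‖} := measurableSet_lt measurable_const measurable_norm
  have hst : Set.Ioi t ×ˢ Set.Ioo (-Real.pi) Real.pi ⊆ polarCoord.target :=
    Set.prod_mono (Set.Ioi_subset_Ioi ht) subset_rfl
  rw [← integral_indicator hm, ← Complex.integral_comp_polarCoord_symm,
    ← Set.inter_eq_self_of_subset_right hst,
    ← setIntegral_indicator (measurableSet_Ioi.prod measurableSet_Ioo)]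
  refine setIntegral_congr_fun polarCoord.open_target.measurableSet fun p hp => ?_
  have hp0 : 0 < p.1 := hp.1
  by_cases h : t < p.1
  · rw [Set.indicator_of_mem (show p ∈ Set.Ioi t ×ˢ _ from ⟨h, hp.2⟩), Set.indicator_of_mem,
      smul_eq_mul]
    simpa [Complex.norm_polarCoord_symm, abs_of_pos hp0] using h
  · rw [Set.indicator_of_notMem, Set.indicator_of_notMem (fun h' => h h'.1), smul_zero]
    simpa [Complex.norm_polarCoord_symm, abs_of_pos hp0] using h

theorem exists_linearIsometryEquiv_complex_apply_norm (v : EuclideanSpace ℝ (Fin 2))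
    (hv : v ≠ 0) : ∃ e : ℂ ≃ₗᵢ[ℝ] EuclideanSpace ℝ (Fin 2), e (‖v‖ : ℂ) = v := by
  let b := Complex.orthonormalBasisOneI.repr
  have hn : ‖b.symm v‖ = ‖v‖ := b.symm.norm_map v
  have hv' : (‖v‖ : ℂ) ≠ 0 := by simpa using hv
  let a : Circle := ⟨b.symm v / ‖v‖, by
    rw [Submonoid.unitSphere, Submonoid.mem_mk, Subsemigroup.mem_mk, mem_sphere_zero_iff_norm,
      norm_div, hn, Complex.norm_real, norm_norm,
      div_self (norm_ne_zero_iff.2 hv)]⟩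
  refine ⟨(rotation a).trans b, ?_⟩
  rw [LinearIsometryEquiv.trans_apply, rotation_apply]
  change b (b.symm v / ‖v‖ * ‖v‖) = v
  rw [div_mul_cancel₀ _ hv', b.apply_symm_apply]

open scoped Pointwise in
theorem setIntegral_lt_norm_scale {ε : ℝ} (hε : 0 < ε) (t : ℝ)
    (e : ℂ ≃ₗᵢ[ℝ] EuclideanSpace ℝ (Fin 2)) (f : EuclideanSpace ℝ (Fin 2) → ℝ) :
    ∫ η in {η : EuclideanSpace ℝ (Fin 2) | t < ‖η‖}, f η =
      ∫ w in {w : ℂ | t / ε < ‖w‖}, ε ^ 2 * f (e (ε • w)) := by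
  have h1 := e.measurePreserving.setIntegral_preimage_emb
    e.toHomeomorph.measurableEmbedding f {η | t < ‖η‖}
  have h2 := Measure.setIntegral_comp_smul_of_pos (volume : Measure ℂ) (fun w => f (e w))
    {w : ℂ | t / ε < ‖w‖} hε
  have hset : ε • {w : ℂ | t / ε < ‖w‖} = e ⁻¹' {η | t < ‖η‖} := by
    ext w
    rw [Set.mem_smul_set_iff_inv_smul_mem₀ hε.ne']
    simp only [Set.mem_ofPred_eq, Set.mem_preimage, e.norm_map, norm_smul, norm_inv,
      Real.norm_eq_abs, abs_of_pos hε]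
    rw [div_lt_iff₀ hε, mul_comm, mul_inv_cancel_left₀ hε.ne']
  rw [integral_const_mul, h2, hset, h1, Complex.finrank_real_complex, smul_eq_mul,
    mul_inv_cancel_left₀ (by positivity)]

theorem setIntegral_alphaFn_mul_inner_div {ε : ℝ} (hε : 0 < ε)
    {η₀ : EuclideanSpace ℝ (Fin 2)} (h0 : 0 < ‖η₀‖) {t : ℝ} (ht : 0 < t) :
    ∫ η in {η : EuclideanSpace ℝ (Fin 2) | t < ‖η‖},
        alphaFn ε η₀ η * ⟪η, η - η₀⟫ / ‖η‖ ^ 3 =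
      (Real.exp (-(‖η₀‖ / ε) ^ 2) / ε) *
        ∫ p in Set.Ioi (t / ε) ×ˢ Set.Ioo (-Real.pi) Real.pi, Real.exp (-p.1 ^ 2) *
          (Real.exp (2 * p.1 * (‖η₀‖ / ε) * Real.cos p.2) *
            (1 - (‖η₀‖ / ε) * Real.cos p.2 / p.1)) := by
  obtain ⟨e, he⟩ := exists_linearIsometryEquiv_complex_apply_norm η₀ (norm_pos_iff.1 h0)
  have hs : 0 < t / ε := div_pos ht hε
  rw [setIntegral_lt_norm_scale hε t e, Complex.setIntegral_lt_norm_eq_polarCoord hs.le,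
    ← integral_const_mul]
  refine setIntegral_congr_fun (measurableSet_Ioi.prod measurableSet_Ioo) fun p hp => ?_
  have hp0 : 0 < p.1 := hs.trans hp.1
  obtain ⟨z, hz⟩ : ∃ z, z = ‖η₀‖ / ε := ⟨_, rfl⟩
  have hη : ‖η₀‖ = ε * z := by rw [hz]; field_simp
  have hnorm : ‖e (ε • Complex.polarCoord.symm p)‖ = ε * p.1 := by
    rw [e.norm_map, norm_smul, Complex.norm_polarCoord_symm, Real.norm_eq_abs, abs_of_pos hε,
      abs_of_pos hp0]
  have hinner : ⟪e (ε • Complex.polarCoord.symm p), η₀⟫ = ε ^ 2 * z * p.1 * Real.cos p.2 := by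
    conv_lhs => rw [← he]
    rw [e.inner_map_map, Complex.inner, Complex.polarCoord_symm_apply, hη]
    simp [-Complex.ofReal_cos, -Complex.ofReal_sin]
    ring
  have hexp : -‖e (ε • Complex.polarCoord.symm p) - η₀‖ ^ 2 / ε ^ 2 =
      -z ^ 2 + (-p.1 ^ 2 + 2 * p.1 * z * Real.cos p.2) := by
    rw [norm_sub_sq_real, hnorm, hinner, hη]
    field_simp
    ring
  simp only [alphaFn]
  rw [hexp, inner_sub_right, real_inner_self_eq_norm_sq, hnorm, hinner, ← hz, Real.exp_add,
    Real.exp_add]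
  field_simp

theorem tendsto_setIntegral_Ioi_nhdsGT_zero {f : ℝ → ℝ} (hf : IntegrableOn f (Set.Ioi 0)) :
    Filter.Tendsto (fun s => ∫ r in Set.Ioi s, f r) (nhdsWithin 0 (Set.Ioi 0))
      (nhds (∫ r in Set.Ioi 0, f r)) := by
  have hc : AECover (volume.restrict (Set.Ioi (0 : ℝ))) (nhdsWithin (0 : ℝ) (Set.Ioi 0))
      fun s => Set.Ioi s := by
    refine ⟨?_, fun _ => measurableSet_Ioi⟩
    filter_upwards [ae_restrict_mem measurableSet_Ioi] with r hr
    filter_upwards [Ioo_mem_nhdsGT hr] with s hs using hs.2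
  refine (hc.integral_tendsto_of_countably_generated hf).congr' ?_
  filter_upwards [self_mem_nhdsWithin] with s hs
  rw [Measure.restrict_restrict measurableSet_Ioi,
    Set.inter_eq_self_of_subset_left (Set.Ioi_subset_Ioi (le_of_lt hs))]

/-- For every `ε > 0` and `η₀ ∈ ℝ²` with `0 < |η₀| ≤ ε`, the principal value
`p.v. ∫_{ℝ²} α_{ε,η₀}(η) ⟨η, η−η₀⟩/|η|³ dη` exists and equals
`(e^{−r̄₀²}/ε)(M₅(r̄₀) − r̄₀²M₃(r̄₀))`, where `r̄₀ = |η₀|/ε`. -/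
theorem stmt8 (ε : ℝ) (hε : 0 < ε) (η₀ : EuclideanSpace ℝ (Fin 2))
    (h0 : 0 < ‖η₀‖) (h1 : ‖η₀‖ ≤ ε)
    (r0 : ℝ) (hr0 : r0 = ‖η₀‖ / ε) :
    Filter.Tendsto
      (fun t : ℝ =>
        ∫ η in {η : EuclideanSpace ℝ (Fin 2) | t < ‖η‖},
          alphaFn ε η₀ η * ⟪η, η - η₀⟫ / ‖η‖ ^ 3)
      (nhdsWithin 0 (Set.Ioi 0))
      (nhds ((Real.exp (-r0 ^ 2) / ε) * (M5R r0 - r0 ^ 2 * M3R r0))) := by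
  subst hr0
  have hz : 0 < ‖η₀‖ / ε := div_pos h0 hε
  have hA := integrableOn_exp_mul_integral_exp_cos hz.le
  have hB := (integrableOn_inv_mul_exp_mul_integral_exp_cos_mul_cos hz.le).const_mul (‖η₀‖ / ε)
  have hlim := tendsto_setIntegral_Ioi_nhdsGT_zero (hA.sub hB)
  have hscale : Filter.Tendsto (fun t : ℝ => t / ε) (nhdsWithin 0 (Set.Ioi 0))
      (nhdsWithin 0 (Set.Ioi 0)) := by
    refine tendsto_nhdsWithin_iff.2 ⟨?_, ?_⟩
    · have h : Filter.Tendsto (fun t : ℝ => t / ε) (nhds 0) (nhds (0 / ε)) :=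
        Filter.tendsto_id.div_const ε
      rw [zero_div] at h
      exact h.mono_left nhdsWithin_le_nhds
    · filter_upwards [self_mem_nhdsWithin] with t ht using div_pos ht hε
  have hval : M5R (‖η₀‖ / ε) - (‖η₀‖ / ε) ^ 2 * M3R (‖η₀‖ / ε) = _ :=
    (show _ = _ by
      rw [M5R, M3R, ← mul_assoc, sq, mul_assoc (‖η₀‖ / ε), mul_inv_cancel₀ hz.ne', mul_one,
        ← integral_const_mul]).trans (integral_sub hA hB).symm
  rw [hval]
  refine ((hlim.comp hscale).const_mul _).congr' ?_
  filter_upwards [self_mem_nhdsWithin] with t ht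
  rw [setIntegral_alphaFn_mul_inner_div hε h0 ht,
    setIntegral_polar_kernel (div_pos ht hε) hz.le]
  rfl
end
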